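/- arXiv:1402.0225 — 6 statements merged into one kernel-verified Lean document; each statement's English description precedes it below -/
import Mathlib

section
/- Axiom 1 of the iALC Hilbert axiomatization is valid: for every constructive model I of iALC (satisfying frame conditions F1 and F2), every role R, and all concepts C and D, the concept ∀R.(C⊑D) ⊑ (∀R.C ⊑ ∀R.D) is satisfied by every element of Δ^I. -/
namespace iALC

/-- iALC concepts: C ::= A | ⊥ | ⊤ | ¬C | C⊓D | C⊔D | C⊑D | ∃R.C | ∀R.C -/
inductive Concept (A R : Type) : Type
  | atom : A → Concept A R
  | bot  : Concept A R
  | top  : Concept A R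
  | neg  : Concept A R → Concept A R
  | and  : Concept A R → Concept A R → Concept A R
  | or   : Concept A R → Concept A R → Concept A R
  | subs : Concept A R → Concept A R → Concept A R
  | ex   : R → Concept A R → Concept A R
  | all  : R → Concept A R → Concept A R
  deriving DecidableEq

/-- A constructive interpretation of iALC. -/
structure Interp (A R : Type) where
  World : Type
  nonempty : Nonempty World
  le : World → World → Prop
  le_refl : ∀ w, le w w
  le_trans : ∀ {u v w}, le u v → le v w → le u w
  rel : R → World → World → Prop
  atom : A → World → Prop
  atom_mono : ∀ a x y, atom a x → le x y → atom a y

/-- Interpretation of concepts: `I.interp C w` means `w ∈ C^I`. -/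
def Interp.interp {A R : Type} (I : Interp A R) : Concept A R → I.World → Prop
  | .atom a, w => I.atom a w
  | .bot, _ => False
  | .top, _ => True
  | .neg C, w => ∀ y, I.le w y → ¬ I.interp C y
  | .and C D, w => I.interp C w ∧ I.interp D w
  | .or C D, w => I.interp C w ∨ I.interp D w
  | .subs C D, w => ∀ y, I.le w y → I.interp C y → I.interp D y
  | .ex r C, w => ∃ y, I.rel r w y ∧ I.interp C y
  | .all r C, w => ∀ y, I.le w y → ∀ z, I.rel r y z → I.interp C z

/-- Frame conditions F1 and F2: a constructive interpretation is a model iff both hold. -/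
def Interp.IsModel {A R : Type} (I : Interp A R) : Prop :=
  (∀ r w w' v, I.le w w' → I.rel r w v → ∃ v', I.rel r w' v' ∧ I.le v v') ∧
  (∀ r w v v', I.le v v' → I.rel r w v → ∃ w', I.rel r w' v' ∧ I.le w w')

/-- A concept is valid in `I` iff it is satisfied by every element of the domain. -/
def Interp.valid {A R : Type} (I : Interp A R) (C : Concept A R) : Prop :=
  ∀ w : I.World, I.interp C w

/-- validity of axiom 1: ∀R.(C⊑D) ⊑ (∀R.C ⊑ ∀R.D). -/
theorem ialc_axiom1_valid {A R : Type} (I : Interp A R) (hI : I.IsModel)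
    (r : R) (C D : Concept A R) :
    ∀ w : I.World,
      I.interp (Concept.subs (Concept.all r (Concept.subs C D))
        (Concept.subs (Concept.all r C) (Concept.all r D))) w := by
  intro w y _ hCD z hyz hC u hzu v huv
  exact hCD u (I.le_trans hyz hzu) v huv v (I.le_refl v) (hC u hzu v huv)

end iALC
end

section
/- Axiom 2 of the iALC Hilbert axiomatization is valid: for every constructive model I of iALC (satisfying frame conditions F1 and F2), every role R, and all concepts C and D, the concept ∀R.(C⊑D) ⊑ (∃R.C ⊑ ∃R.D) is satisfied by every element of Δ^I. -/
namespace iALC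

/-- validity of axiom 2: ∀R.(C⊑D) ⊑ (∃R.C ⊑ ∃R.D). -/
theorem ialc_axiom2_valid {A R : Type} (I : Interp A R) (hI : I.IsModel)
    (r : R) (C D : Concept A R) :
    ∀ w : I.World,
      I.interp (Concept.subs (Concept.all r (Concept.subs C D))
        (Concept.subs (Concept.ex r C) (Concept.ex r D))) w := by
  simp only [Interp.interp]
  rintro w x - hall y hxy ⟨z, hyz, hz⟩
  exact ⟨z, hyz, hall y hxy z hyz z (I.le_refl z) hz⟩

end iALC
end

section
/- Axiom 5 of the iALC Hilbert axiomatization is valid: for every constructive model I of iALC (satisfying frame conditions F1 and F2), every role R, and all concepts C and D, the concept (∃R.C ⊑ ∀R.D) ⊑ ∀R.(C ⊑ D) is satisfied by every element of Δ^I. (The frame condition F2 is used in an essential way in the proof.) -/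
namespace iALC

/-- validity of axiom 5: (∃R.C ⊑ ∀R.D) ⊑ ∀R.(C ⊑ D). -/
theorem ialc_axiom5_valid {A R : Type} (I : Interp A R) (hI : I.IsModel)
    (r : R) (C D : Concept A R) :
    ∀ w : I.World,
      I.interp (Concept.subs (Concept.subs (Concept.ex r C) (Concept.all r D))
        (Concept.all r (Concept.subs C D))) w := by
  intro w w' _ h y hy z hyz z' hz hC
  obtain ⟨y', hyz', hyy'⟩ := hI.2 r y z z' hz hyz
  exact h y' (I.le_trans hy hyy') ⟨z', hyz', hC⟩ y' (I.le_refl y') z' hyz'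

end iALC
end

section
/- The sequent rule ⊑-r is semantically sound at the level of worlds: for every constructive model I of iALC (satisfying frame conditions F1 and F2), every finite set Δ of concepts, and all concepts α and β, if every element z of Δ^I that belongs to γ^I for all γ ∈ Δ and belongs to α^I also belongs to β^I, then every element x of Δ^I that belongs to γ^I for all γ ∈ Δ belongs to (α ⊑ β)^I. -/
namespace iALC

/-- Concept interpretations are closed under refinement in every model. -/
theorem Interp.IsModel.interp_mono {A R : Type} {I : Interp A R} (hI : I.IsModel)
    (C : Concept A R) {x y : I.World} (hxy : I.le x y) (hx : I.interp C x) :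
    I.interp C y := by
  induction C generalizing x y with
  | atom a => exact I.atom_mono a x y hx hxy
  | bot => exact hx
  | top => trivial
  | neg C _ => exact fun z hz => hx z (I.le_trans hxy hz)
  | and C D ihC ihD => exact ⟨ihC hxy hx.1, ihD hxy hx.2⟩
  | or C D ihC ihD => exact Or.imp (ihC hxy) (ihD hxy) hx
  | subs C D _ _ => exact fun z hz => hx z (I.le_trans hxy hz)
  | ex r C ih =>
    obtain ⟨v, hv, hC⟩ := hx
    obtain ⟨v', hv', hle⟩ := hI.1 r x y v hxy hv
    exact ⟨v', hv', ih hle hC⟩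
  | all r C _ => exact fun z hz => hx z (I.le_trans hxy hz)

/-- soundness of the ⊑-r rule at the level of worlds. -/
theorem ialc_subsR_sound {A R : Type} (I : Interp A R) (hI : I.IsModel)
    (Δ : Finset (Concept A R)) (α β : Concept A R)
    (h : ∀ z : I.World, (∀ γ ∈ Δ, I.interp γ z) → I.interp α z → I.interp β z) :
    ∀ x : I.World, (∀ γ ∈ Δ, I.interp γ x) → I.interp (Concept.subs α β) x := by
  exact fun x hx y hxy hα => h y (fun γ hγ => hI.interp_mono γ hxy (hx γ hγ)) hα

end iALC
end

section
/- The sequent rule p-∃ is semantically sound at the level of worlds: for every constructive model I of iALC (satisfying frame conditions F1 and F2), every finite set Δ of concepts, all concepts α and β, and every role R, if every element of Δ^I that belongs to γ^I for all γ ∈ Δ and belongs to α^I also belongs to β^I, then every element of Δ^I that belongs to (∀R.γ)^I for all γ ∈ Δ and belongs to (∃R.α)^I also belongs to (∃R.β)^I. -/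
namespace iALC

/-- soundness of the p-∃ rule at the level of worlds. -/
theorem ialc_pEx_sound {A R : Type} (I : Interp A R) (hI : I.IsModel)
    (Δ : Finset (Concept A R)) (α β : Concept A R) (r : R)
    (h : ∀ z : I.World, (∀ γ ∈ Δ, I.interp γ z) → I.interp α z → I.interp β z) :
    ∀ x : I.World, (∀ γ ∈ Δ, I.interp (Concept.all r γ) x) →
      I.interp (Concept.ex r α) x → I.interp (Concept.ex r β) x := by
  simp only [Interp.interp]
  rintro x hΔ ⟨y, hxy, hα⟩
  exact ⟨y, hxy, h y (fun γ hγ => hΔ γ hγ x (I.le_refl x) y hxy) hα⟩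

end iALC
end

section
/- Relative completeness of SC_iALC with respect to the Hilbert axiomatization of iALC: for all concepts α and β, every role R, and every nominal x, the following sequents are derivable in SC_iALC: (1) ∀R.(α ⊑ β) ⇒ ∃R.α ⊑ ∃R.β; (2) ∀R.(α ⊑ β) ⇒ ∀R.α ⊑ ∀R.β; (3) ⇒ x:(∃R.⊥ ⊑ ⊥); (4) x:∃R.(α ⊔ β) ⇒ x:(∃R.α ⊔ ∃R.β); (5) ⇒ x:((∃R.α ⊑ ∀R.β) ⊑ ∀R.(α ⊑ β)). -/
namespace iALC

/-- Nominal assertions: N ::= x:C | x:N (nominals are natural numbers). -/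
inductive Nassert (A R : Type) : Type
  | conc : ℕ → Concept A R → Nassert A R
  | nest : ℕ → Nassert A R → Nassert A R
  deriving DecidableEq

/-- Formulas of SC_iALC: concepts, nominal assertions, and role assertions xRy. -/
inductive Formula (A R : Type) : Type
  | concept : Concept A R → Formula A R
  | nassert : Nassert A R → Formula A R
  | rel : ℕ → R → ℕ → Formula A R
  deriving DecidableEq

/-- Nominals occurring in a nominal assertion. -/
def Nassert.noms {A R : Type} : Nassert A R → Finset ℕ
  | .conc x _ => {x}
  | .nest x n => insert x n.noms

/-- Nominals occurring in a formula. -/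
def Formula.noms {A R : Type} : Formula A R → Finset ℕ
  | .concept _ => ∅
  | .nassert n => n.noms
  | .rel x _ y => {x, y}

/-- `∀R.`-prefixing: prefixes `∀R.` to concepts, leaves assertions unchanged. -/
def Formula.allPrefix {A R : Type} (r : R) : Formula A R → Formula A R
  | .concept C => .concept (.all r C)
  | f => f

/-- `x:`-prefixing: prefixes `x:` to concepts, leaves assertions unchanged. -/
def Formula.nomPrefix {A R : Type} (x : ℕ) : Formula A R → Formula A R
  | .concept C => .nassert (.conc x C)
  | f => f

/-- The nominal assertion `x:C` as a formula. -/
def nc {A R : Type} (x : ℕ) (C : Concept A R) : Formula A R := .nassert (.conc x C)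

/-- Derivability in the sequent calculus SC_iALC (sequents are `Δ ⇒ δ` with `Δ` a finite set). -/
inductive Deriv {A R : Type} [DecidableEq A] [DecidableEq R] :
    Finset (Formula A R) → Formula A R → Prop
  | ax : ∀ Δ δ, Deriv (insert δ Δ) δ
  | botL : ∀ Δ δ, Deriv (insert (.concept .bot) Δ) δ
  | nbotL : ∀ Δ δ x, Deriv (insert (nc x .bot) Δ) δ
  -- structural rules and cut
  | weak : ∀ Δ δ f, Deriv Δ δ → Deriv (insert f Δ) δ
  | cut : ∀ Δ₁ Δ₂ φ δ, Deriv Δ₁ φ → Deriv (insert φ Δ₂) δ → Deriv (Δ₁ ∪ Δ₂) δ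
  -- role quantification rules
  | allR : ∀ Δ x y r α,
      Deriv (insert (.rel x r y) Δ) (nc y α) → Deriv Δ (nc x (.all r α))
  | allL : ∀ Δ x y r α δ,
      Deriv (insert (nc x (.all r α)) (insert (nc y α) (insert (.rel x r y) Δ))) δ →
      Deriv (insert (nc x (.all r α)) (insert (.rel x r y) Δ)) δ
  | exR : ∀ Δ x y r α,
      Deriv Δ (.rel x r y) → Deriv Δ (nc y α) → Deriv Δ (nc x (.ex r α))
  | exL : ∀ Δ x y r α δ,
      (∀ f ∈ insert (nc x (.ex r α)) Δ, y ∉ f.noms) → y ∉ δ.noms →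
      Deriv (insert (.rel x r y) (insert (nc y α) Δ)) δ →
      Deriv (insert (nc x (.ex r α)) Δ) δ
  -- propositional rules, version without nominals
  | subsR : ∀ Δ α β,
      Deriv (insert (.concept α) Δ) (.concept β) → Deriv Δ (.concept (.subs α β))
  | subsL : ∀ Δ₁ Δ₂ α β δ,
      Deriv Δ₁ (.concept α) → Deriv (insert (.concept β) Δ₂) δ →
      Deriv (insert (.concept (.subs α β)) (Δ₁ ∪ Δ₂)) δ
  | andR : ∀ Δ α β,
      Deriv Δ (.concept α) → Deriv Δ (.concept β) → Deriv Δ (.concept (.and α β))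
  | andL : ∀ Δ α β δ,
      Deriv (insert (.concept α) (insert (.concept β) Δ)) δ →
      Deriv (insert (.concept (.and α β)) Δ) δ
  | orR1 : ∀ Δ α β, Deriv Δ (.concept α) → Deriv Δ (.concept (.or α β))
  | orR2 : ∀ Δ α β, Deriv Δ (.concept β) → Deriv Δ (.concept (.or α β))
  | orL : ∀ Δ α β δ,
      Deriv (insert (.concept α) Δ) δ → Deriv (insert (.concept β) Δ) δ →
      Deriv (insert (.concept (.or α β)) Δ) δ
  -- propositional rules, version with nominals
  | nsubsR : ∀ Δ x α β,
      Deriv (insert (nc x α) Δ) (nc x β) → Deriv Δ (nc x (.subs α β))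
  | nsubsL : ∀ Δ₁ Δ₂ x α β δ,
      Deriv Δ₁ (nc x α) → Deriv (insert (nc x β) Δ₂) δ →
      Deriv (insert (nc x (.subs α β)) (Δ₁ ∪ Δ₂)) δ
  | nandR : ∀ Δ x α β,
      Deriv Δ (nc x α) → Deriv Δ (nc x β) → Deriv Δ (nc x (.and α β))
  | nandL : ∀ Δ x α β δ,
      Deriv (insert (nc x α) (insert (nc x β) Δ)) δ →
      Deriv (insert (nc x (.and α β)) Δ) δ
  | norR1 : ∀ Δ x α β, Deriv Δ (nc x α) → Deriv Δ (nc x (.or α β))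
  | norR2 : ∀ Δ x α β, Deriv Δ (nc x β) → Deriv Δ (nc x (.or α β))
  | norL : ∀ Δ x α β δ,
      Deriv (insert (nc x α) Δ) δ → Deriv (insert (nc x β) Δ) δ →
      Deriv (insert (nc x (.or α β)) Δ) δ
  -- promotion rules
  | pEx : ∀ Δ α β r,
      Deriv (insert (.concept α) Δ) (.concept β) →
      Deriv (insert (.concept (.ex r α)) (Δ.image (Formula.allPrefix r))) (.concept (.ex r β))
  | pAll : ∀ Δ α r,
      Deriv Δ (.concept α) →
      Deriv (Δ.image (Formula.allPrefix r)) (.concept (.all r α))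
  | pN : ∀ Δ δ x,
      Deriv Δ δ → Deriv (Δ.image (Formula.nomPrefix x)) (Formula.nomPrefix x δ)

namespace Deriv

variable {A R : Type} [DecidableEq A] [DecidableEq R]

theorem of_mem {Δ : Finset (Formula A R)} {δ : Formula A R} (h : δ ∈ Δ) : Deriv Δ δ := by
  simpa [Finset.insert_eq_of_mem h] using ax Δ δ

theorem modus_ponens (α β : Concept A R) :
    Deriv {.concept α, .concept (.subs α β)} (.concept β) := by
  have h := subsL {.concept α} ∅ α β (.concept β)
    (of_mem (by simp)) (of_mem (by simp))
  rwa [Finset.union_empty, Finset.pair_comm] at h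

/-- The eigenvariable of `exL` can be taken to be `x + 1` when `x` is the only nominal present. -/
theorem exL_singleton {x : ℕ} {r : R} {α β : Concept A R}
    (h : Deriv {.rel x r (x + 1), nc (x + 1) α} (nc x β)) :
    Deriv {nc x (.ex r α)} (nc x β) := by
  apply exL ∅ x (x + 1) r α
  · simp [nc, Formula.noms, Nassert.noms]
  · simp [nc, Formula.noms, Nassert.noms]
  · exact h

theorem ex_mono_of_all_subs (r : R) (α β : Concept A R) :
    Deriv {.concept (.all r (.subs α β))} (.concept (.subs (.ex r α) (.ex r β))) := by
  apply subsR
  simpa [Formula.allPrefix] using pEx {.concept (.subs α β)} α β r (modus_ponens α β)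

theorem all_mono_of_all_subs (r : R) (α β : Concept A R) :
    Deriv {.concept (.all r (.subs α β))} (.concept (.subs (.all r α) (.all r β))) := by
  apply subsR
  simpa [Finset.image_insert, Formula.allPrefix] using pAll _ _ r (modus_ponens α β)

theorem not_ex_bot (x : ℕ) (r : R) :
    Deriv (∅ : Finset (Formula A R)) (nc x (.subs (.ex r .bot) .bot)) :=
  nsubsR _ _ _ _ (exL_singleton (weak _ _ _ (nbotL ∅ _ _)))

theorem ex_or (x : ℕ) (r : R) (α β : Concept A R) :
    Deriv {nc x (.ex r (.or α β))} (nc x (.or (.ex r α) (.ex r β))) := by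
  apply exL_singleton
  rw [Finset.pair_comm]
  apply norL
  · exact norR1 _ _ _ _ (exR _ _ (x + 1) _ _ (of_mem (by simp)) (of_mem (by simp)))
  · exact norR2 _ _ _ _ (exR _ _ (x + 1) _ _ (of_mem (by simp)) (of_mem (by simp)))

theorem all_subs_of_ex_subs_all (x : ℕ) (r : R) (α β : Concept A R) :
    Deriv (∅ : Finset (Formula A R))
      (nc x (.subs (.subs (.ex r α) (.all r β)) (.all r (.subs α β)))) := by
  apply nsubsR
  apply allR _ x (x + 1)
  apply nsubsR
  have h := nsubsL {nc (x + 1) α, .rel x r (x + 1)} {.rel x r (x + 1)} x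
    (.ex r α) (.all r β) (nc (x + 1) β)
    (exR _ x (x + 1) r α (of_mem (by simp)) (of_mem (by simp)))
    (allL ∅ x (x + 1) r β _ (of_mem (by simp)))
  convert h using 1
  ext f
  simp only [Finset.mem_insert, Finset.mem_union, Finset.mem_singleton, Finset.notMem_empty]
  tauto

end Deriv

/-- the five Hilbert axioms of iALC are derivable in SC_iALC. -/
theorem scialc_derives_hilbert_axioms {A R : Type} [DecidableEq A] [DecidableEq R]
    (α β : Concept A R) (r : R) (x : ℕ) :
    Deriv ({Formula.concept (Concept.all r (Concept.subs α β))} : Finset (Formula A R))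
        (Formula.concept (Concept.subs (Concept.ex r α) (Concept.ex r β))) ∧
    Deriv ({Formula.concept (Concept.all r (Concept.subs α β))} : Finset (Formula A R))
        (Formula.concept (Concept.subs (Concept.all r α) (Concept.all r β))) ∧
    Deriv (∅ : Finset (Formula A R))
        (nc x (Concept.subs (Concept.ex r Concept.bot) Concept.bot)) ∧
    Deriv ({nc x (Concept.ex r (Concept.or α β))} : Finset (Formula A R))
        (nc x (Concept.or (Concept.ex r α) (Concept.ex r β))) ∧
    Deriv (∅ : Finset (Formula A R))
        (nc x (Concept.subs (Concept.subs (Concept.ex r α) (Concept.all r β))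
          (Concept.all r (Concept.subs α β)))) := by
  exact ⟨Deriv.ex_mono_of_all_subs r α β, Deriv.all_mono_of_all_subs r α β,
    Deriv.not_ex_bot x r, Deriv.ex_or x r α β, Deriv.all_subs_of_ex_subs_all x r α β⟩

end iALC
end
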